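/- arXiv:2303.03865 — 3 statements merged into one kernel-verified Lean document; each statement's English description precedes it below -/
import Mathlib

section
/- Fugal extension preserves composition of Mealy machines: for all e ∈ E, f ∈ F and all lists ℓ over A, the fugal extension of the composite output map s₂ ⋄ s₁ (taken with respect to the composite dynamics d₂ ⋄ d₁) satisfies (s₂ ⋄ s₁)♭ (e, f) ℓ = s₂♭ f (s₁♭ e ℓ), where s₁♭ is the fugal extension of s₁ with respect to d₁ and s₂♭ is the fugal extension of s₂ with respect to d₂. -/
/-- Extension of the dynamics `d : E → A → E` of a Mealy machine to the free monoid `List A`. -/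
def dstar {E A : Type*} (d : E → A → E) : E → List A → E
  | e, [] => e
  | e, a :: as => dstar d (d e a) as

/-- The fugal extension `s♭ : E → List A → List B` of the output map `s : E → A → B`
of a Mealy machine with dynamics `d`. -/
def sflat {E A B : Type*} (d : E → A → E) (s : E → A → B) : E → List A → List B
  | _, [] => []
  | e, a :: as => s e a :: sflat d s (d e a) as

/-- Fugal extension preserves composition of Mealy machines:
`(s₂ ⋄ s₁)♭ (e, f) ℓ = s₂♭ f (s₁♭ e ℓ)`, where the composite machine has dynamics
`(d₂ ⋄ d₁) ((e, f), a) = (d₁ e a, d₂ f (s₁ e a))` and output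
`(s₂ ⋄ s₁) ((e, f), a) = s₂ f (s₁ e a)`. -/
theorem fugal_extension_comp {E F A B C : Type*}
    (d₁ : E → A → E) (s₁ : E → A → B) (d₂ : F → B → F) (s₂ : F → B → C) :
    ∀ (e : E) (f : F) (ℓ : List A),
      sflat (fun p a => (d₁ p.1 a, d₂ p.2 (s₁ p.1 a)))
            (fun p a => s₂ p.2 (s₁ p.1 a)) (e, f) ℓ
        = sflat d₂ s₂ f (sflat d₁ s₁ e ℓ) := by
  intro e f ℓ
  induction ℓ generalizing e f with
  | nil => rfl
  | cons a as ih => exact congrArg (s₂ f (s₁ e a) :: ·) (ih (d₁ e a) (d₂ f (s₁ e a)))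
end

section
/- The terminal Mealy machine in Set with input set I and output set O has state space Ω = (List I → I → O), dynamics δ : Ω → I → Ω given by δ g i = fun ℓ j => g (i :: ℓ) j, and output σ : Ω → I → O given by σ g j = g [] j. That is, for every Mealy machine (E, d, s) with input I and output O there exists a unique function h : E → Ω such that σ (h e) j = s e j and h (d e i) = δ (h e) i for all e ∈ E, i, j ∈ I. -/
/-- The terminal Mealy machine in `Set` of input `I` and output `O` has state space
`Ω = (List I → I → O)`, dynamics `δ g i = fun ℓ j => g (i :: ℓ) j` and output
`σ g j = g [] j`: every Mealy machine `(E, d, s)` admits a unique morphism `h : E → Ω`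
to it. -/
theorem terminal_mealy {I O : Type*} {E : Type*} (d : E → I → E) (s : E → I → O) :
    ∃! h : E → (List I → I → O),
      (∀ (e : E) (j : I), h e [] j = s e j) ∧
      (∀ (e : E) (i : I), h (d e i) = fun ℓ j => h e (i :: ℓ) j) := by
  refine ⟨fun e ℓ j => s (ℓ.foldl d e) j, ⟨fun _ _ => rfl, fun _ _ => rfl⟩, ?_⟩
  rintro h ⟨hs, hd⟩
  funext e ℓ j
  induction ℓ generalizing e with
  | nil => exact hs e j
  | cons i ℓ ih => exact (congrFun₂ (hd e i) ℓ j).symm.trans (ih (d e i))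
end

section
/- Let P : Type u → Type u be a commutative lawful monad (LawfulMonad and CommApplicative). Given Kleisli Mealy machines (E, d, s) and (F, d', s') with input I and output O (d : E → I → P E, s : E → I → P O, d' : F → I → P F, s' : F → I → P O), define the extended deterministic machines on state spaces P E and P F, with inputs P I and outputs P O, by dᵉ S T = (do e ← S; i ← T; d e i), sᵉ S T = (do e ← S; i ← T; s e i), and similarly d'ᵉ, s'ᵉ. If φ : E → P F is a 2-cell of Kleisli machines, i.e. for all e, i: (do x ← d e i; φ x) = (do y ← φ e; d' y i) and s e i = (do y ← φ e; s' y i), then Φ : P E → P F defined by Φ S = S >>= φ is a morphism of the extended machines: for all S : P E and T : P I, d'ᵉ (Φ S) T = Φ (dᵉ S T) and s'ᵉ (Φ S) T = sᵉ S T. -/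
universe u

/-- Independent computations in a commutative monad can be interchanged. -/
theorem CommApplicative.bind_comm {P : Type u → Type u} [Monad P] [LawfulMonad P]
    [CommApplicative P] {α β γ : Type u} (a : P α) (b : P β) (k : α → β → P γ) :
    (a >>= fun x => b >>= fun y => k x y) = b >>= fun y => a >>= fun x => k x y := by
  have h := congrArg (· >>= id) (CommApplicative.commutative_map a b (f := k))
  simpa [seq_eq_bind_map, flip] using h

/-- The extension functor for a commutative lawful monad `P`, from Mealy machines in the
Kleisli category of `P` with input `I` and output `O` to Mealy machines in `Set` with input
`P I` and output `P O`: a 2-cell `φ : E → P F` of Kleisli machines induces a morphism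
`Φ S = S >>= φ` between the extended machines
`dᵉ S T = (do e ← S; i ← T; d e i)`, `sᵉ S T = (do e ← S; i ← T; s e i)`. -/
theorem kleisli_extension_functor {P : Type u → Type u} [Monad P] [LawfulMonad P]
    [CommApplicative P] {E F I O : Type u}
    (d : E → I → P E) (s : E → I → P O) (d' : F → I → P F) (s' : F → I → P O)
    (φ : E → P F)
    (h₁ : ∀ (e : E) (i : I), (do let x ← d e i; φ x) = (do let y ← φ e; d' y i))
    (h₂ : ∀ (e : E) (i : I), s e i = (do let y ← φ e; s' y i)) :
    ∀ (S : P E) (T : P I),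
      (do let y ← S >>= φ; let i ← T; d' y i)
        = (do let e ← S; let i ← T; d e i) >>= φ ∧
      (do let y ← S >>= φ; let i ← T; s' y i)
        = (do let e ← S; let i ← T; s e i) := by
  intro S T
  simp only [bind_assoc, h₁, h₂]
  constructor <;> congr 1 <;> funext e <;> exact CommApplicative.bind_comm _ _ _
end
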